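/- (Global-in-time quadratic bound on the value, Lemma on |V| in Subsection 5.7.) Let c, c_T, δ, K > 0 and t < T be arbitrary (no smallness condition on T−t). Let H : [t,T]×ℝⁿ×ℝⁿ → ℝ and f : [t,T]×ℝⁿ → ℝ satisfy |H(s,x,p)| ≤ c(1+|x|²) + (δ/2)|p|² and |f(s,x)| ≤ c(1+|x|²), and let h, f_T : ℝⁿ → ℝ satisfy |h(x)| ≤ c_T(1+|x|²) and |f_T(x)| ≤ c_T(1+|x|²). Let V : [t,T]×ℝⁿ → ℝ be continuous, C¹ in s and C² in x on [t,T)×ℝⁿ, solve −∂_s V + 𝒜V = H(s,x,DV) + f on [t,T)×ℝⁿ with V(T,x) = h(x) + f_T(x), and satisfy the gradient bound |DV(s,x)| ≤ K(1+|x|). Set C₀ := 2c + δK², β(s) := 4c_T + 2C₀(T−s), μ(s) := 2c_T + ∫_s^T ( C₀ + [2c_T + C₀(T−τ)]·tr(a) ) dτ and z(s,x) := β(s)·|x|²/2 + μ(s). If moreover limsup_{R→∞} sup_{s∈[t,T], |x|≥R} (V(s,x) − z(s,x)) ≤ 0 and liminf_{R→∞} inf_{s∈[t,T], |x|≥R}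 (V(s,x) + z(s,x)) ≥ 0, then −z(s,x) ≤ V(s,x) ≤ z(s,x) for all (s,x) ∈ [t,T]×ℝⁿ; in particular |V(s,x)| ≤ C(1+|x|²) for a constant C depending only on c, c_T, δ, K, tr(a) and T−t. -/

import Mathlib

open Real MeasureTheory Matrix

noncomputable section

abbrev Euc (n : ℕ) := EuclideanSpace ℝ (Fin n)

/-- Second partial derivative `∂²φ/(∂x_i ∂x_j)(x)`. -/
def secondPartial (n : ℕ) (φ : Euc n → ℝ) (x : Euc n) (i j : Fin n) : ℝ :=
  fderiv ℝ (fun y => fderiv ℝ φ y (EuclideanSpace.single j 1)) x (EuclideanSpace.single i 1)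

/-- The operator `𝒜φ(x) = −(1/2)·∑_{i,j} a_{ij}·∂²φ/(∂x_i∂x_j)(x)`. -/
def opA (n : ℕ) (a : Matrix (Fin n) (Fin n) ℝ) (φ : Euc n → ℝ) (x : Euc n) : ℝ :=
  -(1 / 2) * ∑ i, ∑ j, a i j * secondPartial n φ x i j

theorem secondPartial_eq {n : ℕ} {φ : Euc n → ℝ} (hφ : ContDiff ℝ 2 φ) (x : Euc n) (i j : Fin n) :
    secondPartial n φ x i j =
      fderiv ℝ (fderiv ℝ φ) x (EuclideanSpace.single i 1) (EuclideanSpace.single j 1) := by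
  have hd : DifferentiableAt ℝ (fderiv ℝ φ) x :=
    (hφ.fderiv_right (m := 1) (by norm_num)).differentiable (by norm_num) x
  simp [secondPartial, fderiv_clm_apply hd (differentiableAt_const _)]

theorem opA_neg {n : ℕ} (a : Matrix (Fin n) (Fin n) ℝ) (φ : Euc n → ℝ) (x : Euc n) :
    opA n a (fun y => -φ y) x = -opA n a φ x := by
  simp [opA, secondPartial]

theorem opA_sub {n : ℕ} (a : Matrix (Fin n) (Fin n) ℝ) {φ ψ : Euc n → ℝ}
    (hφ : ContDiff ℝ 2 φ) (hψ : ContDiff ℝ 2 ψ) (x : Euc n) :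
    opA n a (fun y => φ y - ψ y) x = opA n a φ x - opA n a ψ x := by
  have hd : ∀ {χ : Euc n → ℝ}, ContDiff ℝ 2 χ → DifferentiableAt ℝ (fderiv ℝ χ) x := fun hχ =>
    (hχ.fderiv_right (m := 1) (by norm_num)).differentiable (by norm_num) x
  have h1 : fderiv ℝ (fun y => φ y - ψ y) = fun y => fderiv ℝ φ y - fderiv ℝ ψ y := by
    funext y
    exact fderiv_fun_sub (hφ.differentiable (by norm_num) y) (hψ.differentiable (by norm_num) y)
  have h2 : ∀ i j, secondPartial n (fun y => φ y - ψ y) x i j =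
      secondPartial n φ x i j - secondPartial n ψ x i j := by
    intro i j
    rw [secondPartial_eq (hφ.sub hψ), secondPartial_eq hφ, secondPartial_eq hψ, h1,
      fderiv_fun_sub (hd hφ) (hd hψ)]
    rfl
  simp only [opA, h2, mul_sub, Finset.sum_sub_distrib]

theorem opA_quadratic {n : ℕ} (a : Matrix (Fin n) (Fin n) ℝ) (b m : ℝ) (x : Euc n) :
    opA n a (fun y => b * ‖y‖ ^ 2 / 2 + m) x = -(1 / 2) * (b * a.trace) := by
  have h1 : ∀ (y v : Euc n), fderiv ℝ (fun y : Euc n => b * ‖y‖ ^ 2 / 2 + m) y v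
      = b * inner ℝ v y := by
    intro y v
    have h := ((((hasStrictFDerivAt_norm_sq y).hasFDerivAt.const_mul b).mul_const
      (2⁻¹ : ℝ)).add_const m)
    simp only [← div_eq_mul_inv] at h
    rw [h.fderiv]
    simp [real_inner_comm]
    ring
  have h2 : ∀ i j, secondPartial n (fun y : Euc n => b * ‖y‖ ^ 2 / 2 + m) x i j =
      if i = j then b else 0 := by
    intro i j
    have h3 : (fun y : Euc n => fderiv ℝ (fun y : Euc n => b * ‖y‖ ^ 2 / 2 + m) y
        (EuclideanSpace.single j 1)) =
        ⇑(b • innerSL ℝ (EuclideanSpace.single j (1 : ℝ))) := by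
      funext y
      rw [h1]
      simp
    rw [secondPartial, h3, ContinuousLinearMap.fderiv]
    by_cases hij : i = j
    · subst hij; simp
    · simp [EuclideanSpace.inner_single_left, hij, Ne.symm hij]
  simp only [opA, h2, mul_ite, mul_zero, Finset.sum_ite_eq, Finset.mem_univ, if_true]
  rw [← Finset.sum_mul, Matrix.trace]
  simp only [Matrix.diag_apply]
  ring

theorem fderiv_fderiv_nonpos_of_isLocalMax {E : Type*} [NormedAddCommGroup E] [NormedSpace ℝ E]
    {φ : E → ℝ} {x : E} (hφ : ContDiff ℝ 2 φ) (hx : IsLocalMax φ x) (v : E) :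
    fderiv ℝ (fderiv ℝ φ) x v v ≤ 0 := by
  by_contra! hpos
  set g : ℝ → ℝ := fun r => φ (x + r • v) with hg
  have hline : ∀ r : ℝ, HasDerivAt (fun r : ℝ => x + r • v) v r := fun r => by
    simpa using ((hasDerivAt_id r).smul_const v).const_add x
  have hg' : deriv g = fun r => fderiv ℝ φ (x + r • v) v := by
    funext r
    exact ((hφ.differentiable (by norm_num) _).hasFDerivAt.comp_hasDerivAt r (hline r)).deriv
  have hd : Differentiable ℝ (fderiv ℝ φ) :=
    (hφ.fderiv_right (m := 1) (by norm_num)).differentiable (by norm_num)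
  have hg'' : deriv (deriv g) 0 = fderiv ℝ (fderiv ℝ φ) x v v := by
    rw [hg']
    have h := (((hd _).hasFDerivAt.comp_hasDerivAt (0 : ℝ) (hline 0))).clm_apply
      (hasDerivAt_const (0 : ℝ) v)
    simpa only [Function.comp_apply, zero_smul, add_zero, map_zero] using h.deriv
  have hcont : Continuous fun r : ℝ => x + r • v := by fun_prop
  have hmax : IsLocalMax g 0 := by
    have ht : Filter.Tendsto (fun r : ℝ => x + r • v) (nhds 0) (nhds x) := by
      simpa using hcont.tendsto 0
    filter_upwards [ht.eventually hx] with r hr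
    simpa [hg] using hr
  have hmin : IsLocalMin g 0 :=
    isLocalMin_of_deriv_deriv_pos (hg''.symm ▸ hpos) hmax.deriv_eq_zero
      (hφ.continuous.comp hcont).continuousAt
  have hconst : g =ᶠ[nhds 0] fun _ => g 0 := by
    filter_upwards [hmax, hmin] with r h1 h2 using le_antisymm h1 h2
  have hzero : deriv (deriv g) 0 = 0 := by
    rw [hconst.deriv.deriv_eq]
    simp
  linarith

theorem opA_nonneg_of_isLocalMax {n : ℕ} (σM : Matrix (Fin n) (Fin n) ℝ) {φ : Euc n → ℝ}
    {x : Euc n} (hφ : ContDiff ℝ 2 φ) (hx : IsLocalMax φ x) :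
    0 ≤ opA n (σM * σMᵀ) φ x := by
  set B := fderiv ℝ (fderiv ℝ φ) x
  set e : Fin n → Euc n := fun i => EuclideanSpace.single i 1
  have key : ∑ i, ∑ j, (σM * σMᵀ) i j * secondPartial n φ x i j =
      ∑ k, B (∑ i, σM i k • e i) (∑ j, σM j k • e j) := by
    have hexp : ∀ k, B (∑ i, σM i k • e i) (∑ j, σM j k • e j) =
        ∑ i, ∑ j, σM i k * σM j k * B (e i) (e j) := fun k => by
      simp only [map_sum, map_smul, _root_.sum_apply,
        _root_.smul_apply, smul_eq_mul, Finset.mul_sum]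
      rw [Finset.sum_comm]
      exact Finset.sum_congr rfl fun i _ => Finset.sum_congr rfl fun j _ => by ring
    simp only [hexp, secondPartial_eq hφ, Matrix.mul_apply, Matrix.transpose_apply,
      Finset.sum_mul]
    rw [Finset.sum_comm (s := Finset.univ (α := Fin n)) (t := Finset.univ)
      (f := fun k i => ∑ j, σM i k * σM j k * B (e i) (e j))]
    exact Finset.sum_congr rfl fun i _ => Finset.sum_comm
  have hle : ∑ k, B (∑ i, σM i k • e i) (∑ j, σM j k • e j) ≤ 0 :=
    Finset.sum_nonpos fun k _ => fderiv_fderiv_nonpos_of_isLocalMax hφ hx _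
  rw [opA, key]
  linarith

theorem deriv_nonpos_of_forall_Ico_le {g : ℝ → ℝ} {s T : ℝ} (hsT : s < T)
    (hg : DifferentiableAt ℝ g s) (hmax : ∀ r ∈ Set.Ico s T, g r ≤ g s) : deriv g s ≤ 0 := by
  have hslope := (hasDerivAt_iff_tendsto_slope.1 hg.hasDerivAt).mono_left
    (nhdsWithin_mono s (fun r (hr : r ∈ Set.Ioi s) => ne_of_gt hr))
  refine le_of_tendsto hslope ?_
  filter_upwards [Ioo_mem_nhdsGT hsT] with r hr
  rw [slope_def_field]
  exact div_nonpos_of_nonpos_of_nonneg (sub_nonpos.2 (hmax r ⟨hr.1.le, hr.2⟩))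
    (sub_nonneg.2 hr.1.le)

/-- The weak maximum principle for the backward operator `-∂ₛ + 𝒜` on `[t,T] × ℝⁿ`. -/
theorem parabolic_maximum_principle {n : ℕ} (σM : Matrix (Fin n) (Fin n) ℝ) {t T : ℝ}
    {w : ℝ → Euc n → ℝ}
    (hcont : ContinuousOn (fun p : ℝ × Euc n => w p.1 p.2) (Set.Icc t T ×ˢ Set.univ))
    (hwt : ∀ x : Euc n, ∀ s ∈ Set.Ico t T, DifferentiableAt ℝ (fun r => w r x) s)
    (hwx : ∀ s ∈ Set.Ico t T, ContDiff ℝ 2 (w s))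
    (hsub : ∀ s ∈ Set.Ico t T, ∀ x : Euc n,
      -(deriv (fun r => w r x) s) + opA n (σM * σMᵀ) (w s) x ≤ 0)
    (hterm : ∀ x, w T x ≤ 0)
    (hinf : ∀ ε > (0 : ℝ), ∃ R : ℝ, ∀ s ∈ Set.Icc t T, ∀ x : Euc n, R ≤ ‖x‖ → w s x ≤ ε) :
    ∀ s ∈ Set.Icc t T, ∀ x, w s x ≤ 0 := by
  intro s₀ hs₀ x₀
  by_contra! hpos
  have htT : t ≤ T := hs₀.1.trans hs₀.2
  set m := w s₀ x₀ with hm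
  set η := m / (2 * (T - t + 1)) with hη
  have hη0 : 0 < η := by
    have : 0 ≤ T - t := sub_nonneg.2 htT
    positivity
  have hηm : η * (T - t) < m / 2 := by
    have : η * (T - t + 1) = m / 2 := by
      rw [hη]; field_simp [show T - t + 1 ≠ 0 by linarith]
    linarith
  obtain ⟨R, hR⟩ := hinf (m / 2) (by linarith)
  set g : ℝ × Euc n → ℝ := fun p => w p.1 p.2 - η * (T - p.1) with hg
  have hgcont : ContinuousOn g (Set.Icc t T ×ˢ Metric.closedBall 0 (max R ‖x₀‖)) :=
    (hcont.mono (Set.prod_mono_right (Set.subset_univ _))).sub (by fun_prop)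
  obtain ⟨⟨s₁, x₁⟩, ⟨hs₁, -⟩, hmax⟩ := (isCompact_Icc.prod (isCompact_closedBall _ _)).exists_isMaxOn
    ⟨(s₀, x₀), hs₀, by simp⟩ hgcont
  have hg₀ : m / 2 < g (s₀, x₀) := by
    have : η * (T - s₀) ≤ η * (T - t) := by gcongr; exact hs₀.1
    simp only [hg]; linarith
  have hg₁ : m / 2 < g (s₁, x₁) := hg₀.trans_le (hmax ⟨hs₀, by simp⟩)
  have hglob : ∀ s ∈ Set.Icc t T, ∀ x, g (s, x) ≤ g (s₁, x₁) := by
    intro s hs x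
    by_cases hx : ‖x‖ ≤ max R ‖x₀‖
    · exact hmax ⟨hs, by simpa using hx⟩
    · have h1 := hR s hs x ((le_max_left _ _).trans (not_le.1 hx).le)
      have h2 : 0 ≤ η * (T - s) := mul_nonneg hη0.le (sub_nonneg.2 hs.2)
      have h3 : g (s, x) ≤ m / 2 := by simp only [hg]; linarith
      linarith
  simp only [hg] at hg₁ hglob
  simp only at hs₁
  have hs₁T : s₁ < T := by
    refine lt_of_le_of_ne hs₁.2 fun h => ?_
    have := hterm x₁
    rw [h] at hg₁
    linarith
  have hs₁' : s₁ ∈ Set.Ico t T := ⟨hs₁.1, hs₁T⟩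
  have hA : 0 ≤ opA n (σM * σMᵀ) (w s₁) x₁ :=
    opA_nonneg_of_isLocalMax σM (hwx s₁ hs₁')
      (Filter.Eventually.of_forall fun x => by linarith [hglob s₁ hs₁ x])
  have hderiv : HasDerivAt (fun r => w r x₁ - η * (T - r)) (deriv (fun r => w r x₁) s₁ + η) s₁ := by
    simpa using (hwt x₁ s₁ hs₁').hasDerivAt.fun_sub
      (((hasDerivAt_id' s₁).const_sub T).const_mul η)
  have hle := deriv_nonpos_of_forall_Ico_le hs₁T hderiv.differentiableAt
    fun r hr => hglob r ⟨hs₁.1.trans hr.1, hr.2.le⟩ x₁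
  rw [hderiv.deriv] at hle
  linarith [hsub s₁ hs₁' x₁]

/-- **global-in-time quadratic bound on the value.** With no smallness
condition on `T − t`, a solution of the HJB equation satisfying the gradient bound
`|DV| ≤ K(1+|x|)` obeys `−z ≤ V ≤ z` with the explicit quadratic majorant
`z(s,x) = β(s)|x|²/2 + μ(s)`; in particular `|V(s,x)| ≤ C(1+|x|²)`. -/
theorem global_quadratic_bound
    (n : ℕ) (hn : 1 ≤ n) (σM : Matrix (Fin n) (Fin n) ℝ) (hσ : IsUnit σM.det)
    (a : Matrix (Fin n) (Fin n) ℝ) (ha : a = σM * σMᵀ)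
    (c cT δ K t T : ℝ) (hc : 0 < c) (hcT : 0 < cT) (hδ : 0 < δ) (hK : 0 < K) (htT : t < T)
    -- the data
    (H : ℝ → Euc n → Euc n → ℝ) (f : ℝ → Euc n → ℝ) (h fT : Euc n → ℝ)
    (hH : ∀ s ∈ Set.Icc t T, ∀ x p : Euc n, |H s x p| ≤ c * (1 + ‖x‖ ^ 2) + δ / 2 * ‖p‖ ^ 2)
    (hf : ∀ s ∈ Set.Icc t T, ∀ x : Euc n, |f s x| ≤ c * (1 + ‖x‖ ^ 2))
    (hh : ∀ x : Euc n, |h x| ≤ cT * (1 + ‖x‖ ^ 2))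
    (hfT : ∀ x : Euc n, |fT x| ≤ cT * (1 + ‖x‖ ^ 2))
    -- the solution V
    (V : ℝ → Euc n → ℝ)
    (hVcont : ContinuousOn (fun p : ℝ × Euc n => V p.1 p.2) (Set.Icc t T ×ˢ Set.univ))
    (hVt : ∀ x : Euc n, ∀ s ∈ Set.Ico t T, DifferentiableAt ℝ (fun σ' => V σ' x) s)
    (hVx : ∀ s ∈ Set.Ico t T, ContDiff ℝ 2 (V s))
    (hPDE : ∀ s ∈ Set.Ico t T, ∀ x : Euc n,
      -(deriv (fun σ' => V σ' x) s) + opA n a (V s) x = H s x (gradient (V s) x) + f s x)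
    (hterm : ∀ x : Euc n, V T x = h x + fT x)
    -- the gradient bound
    (hDV : ∀ s ∈ Set.Icc t T, ∀ x : Euc n, ‖gradient (V s) x‖ ≤ K * (1 + ‖x‖))
    -- the explicit majorant
    (C₀ : ℝ) (hC₀ : C₀ = 2 * c + δ * K ^ 2)
    (β μ : ℝ → ℝ) (z : ℝ → Euc n → ℝ)
    (hβ : ∀ s, β s = 4 * cT + 2 * C₀ * (T - s))
    (hμ : ∀ s, μ s = 2 * cT + ∫ τ in s..T, (C₀ + (2 * cT + C₀ * (T - τ)) * a.trace))
    (hz : ∀ s x, z s x = β s * ‖x‖ ^ 2 / 2 + μ s)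
    -- conditions at infinity
    (hupper : ∀ ε > (0 : ℝ), ∃ R : ℝ, ∀ s ∈ Set.Icc t T, ∀ x : Euc n, R ≤ ‖x‖ →
      V s x - z s x ≤ ε)
    (hlower : ∀ ε > (0 : ℝ), ∃ R : ℝ, ∀ s ∈ Set.Icc t T, ∀ x : Euc n, R ≤ ‖x‖ →
      -ε ≤ V s x + z s x) :
    (∀ s ∈ Set.Icc t T, ∀ x : Euc n, -z s x ≤ V s x ∧ V s x ≤ z s x) ∧
    (∃ C > (0 : ℝ), ∀ s ∈ Set.Icc t T, ∀ x : Euc n, |V s x| ≤ C * (1 + ‖x‖ ^ 2)) := by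
  subst ha
  have hC₀0 : 0 < C₀ := by rw [hC₀]; positivity
  set tr := (σM * σMᵀ).trace with htr
  have htr0 : 0 ≤ tr := by
    simp only [htr, Matrix.trace, Matrix.diag_apply, Matrix.mul_apply, Matrix.transpose_apply]
    exact Finset.sum_nonneg fun i _ => Finset.sum_nonneg fun j _ => mul_self_nonneg _
  have hμ' : ∀ s, HasDerivAt μ (-(C₀ + (2 * cT + C₀ * (T - s)) * tr)) s := by
    intro s
    have hc : Continuous fun τ => C₀ + (2 * cT + C₀ * (T - τ)) * tr := by fun_prop
    rw [funext hμ]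
    exact (intervalIntegral.integral_hasDerivAt_left (hc.intervalIntegrable _ _)
      (hc.stronglyMeasurableAtFilter _ _) hc.continuousAt).const_add _
  have hβ' : ∀ s, HasDerivAt β (-(2 * C₀)) s := by
    intro s
    rw [funext hβ]
    have := (((hasDerivAt_id s).const_sub T).const_mul (2 * C₀)).const_add (4 * cT)
    simpa using this
  have hzt : ∀ x s, HasDerivAt (fun r => z r x)
      (-(2 * C₀) * ‖x‖ ^ 2 / 2 + -(C₀ + (2 * cT + C₀ * (T - s)) * tr)) s := by
    intro x s
    rw [show (fun r => z r x) = fun r => β r * ‖x‖ ^ 2 / 2 + μ r from funext fun r => hz r x]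
    exact (((hβ' s).mul_const _).div_const 2).add (hμ' s)
  have hzx : ∀ s, ContDiff ℝ 2 (z s) := by
    intro s
    rw [funext (hz s)]
    exact (((contDiff_const.mul (contDiff_norm_sq ℝ)).div_const 2).add contDiff_const)
  have hzA : ∀ s x, opA n (σM * σMᵀ) (z s) x = -(2 * cT + C₀ * (T - s)) * tr := by
    intro s x
    rw [funext (hz s), opA_quadratic, hβ]
    ring
  have hβc : Continuous β := continuous_iff_continuousAt.2 fun s => (hβ' s).continuousAt
  have hμc : Continuous μ := continuous_iff_continuousAt.2 fun s => (hμ' s).continuousAt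
  have hzc : Continuous fun p : ℝ × Euc n => z p.1 p.2 := by
    simp only [hz]
    fun_prop
  have hzT : ∀ x, z T x = 2 * cT * (1 + ‖x‖ ^ 2) := by
    intro x
    rw [hz, hβ, hμ, intervalIntegral.integral_same]
    ring
  have hVT : ∀ x, |V T x| ≤ z T x := by
    intro x
    rw [hterm, hzT]
    linarith [abs_add_le (h x) (fT x), hh x, hfT x]
  have hsource : ∀ s ∈ Set.Ico t T, ∀ x,
      |-(deriv (fun r => V r x) s) + opA n (σM * σMᵀ) (V s) x| ≤ C₀ * (1 + ‖x‖ ^ 2) := by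
    intro s hs x
    have hs' := Set.Ico_subset_Icc_self hs
    rw [hPDE s hs x]
    have h1 : ‖gradient (V s) x‖ ^ 2 ≤ 2 * K ^ 2 * (1 + ‖x‖ ^ 2) := by
      have h2 : ‖gradient (V s) x‖ ^ 2 ≤ (K * (1 + ‖x‖)) ^ 2 := by
        gcongr
        exact hDV s hs' x
      nlinarith [mul_nonneg (sq_nonneg K) (sq_nonneg (1 - ‖x‖))]
    have h3 := mul_le_mul_of_nonneg_left h1 (half_pos hδ).le
    rw [hC₀]
    linarith [abs_add_le (H s x (gradient (V s) x)) (f s x), hH s hs' x (gradient (V s) x),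
      hf s hs' x]
  have hmajorant : ∀ U : ℝ → Euc n → ℝ,
      ContinuousOn (fun p : ℝ × Euc n => U p.1 p.2) (Set.Icc t T ×ˢ Set.univ) →
      (∀ x : Euc n, ∀ s ∈ Set.Ico t T, DifferentiableAt ℝ (fun r => U r x) s) →
      (∀ s ∈ Set.Ico t T, ContDiff ℝ 2 (U s)) →
      (∀ s ∈ Set.Ico t T, ∀ x, -(deriv (fun r => U r x) s) + opA n (σM * σMᵀ) (U s) x ≤
        C₀ * (1 + ‖x‖ ^ 2)) →
      (∀ x, U T x ≤ z T x) →
      (∀ ε > (0 : ℝ), ∃ R : ℝ, ∀ s ∈ Set.Icc t T, ∀ x : Euc n, R ≤ ‖x‖ → U s x - z s x ≤ ε) →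
      ∀ s ∈ Set.Icc t T, ∀ x, U s x ≤ z s x := by
    intro U hUc hUt hUx hUsub hUT hUinf s hs x
    refine sub_nonpos.1 (parabolic_maximum_principle σM (w := fun s x => U s x - z s x)
      (hUc.sub hzc.continuousOn) (fun x s hs => (hUt x s hs).sub (hzt x s).differentiableAt)
      (fun s hs => (hUx s hs).sub (hzx s)) (fun s hs x => ?_) (fun x => sub_nonpos.2 (hUT x))
      hUinf s hs x)
    rw [((hUt x s hs).hasDerivAt.fun_sub (hzt x s)).deriv, opA_sub _ (hUx s hs) (hzx s), hzA]
    linarith [hUsub s hs x]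
  have hbound : ∀ s ∈ Set.Icc t T, ∀ x : Euc n, -z s x ≤ V s x ∧ V s x ≤ z s x := by
    intro s hs x
    refine ⟨?_, hmajorant V hVcont hVt hVx (fun s hs x => (abs_le.1 (hsource s hs x)).2)
      (fun x => (abs_le.1 (hVT x)).2) hupper s hs x⟩
    have hneg := hmajorant (fun s x => -V s x) hVcont.neg (fun x s hs => (hVt x s hs).neg)
      (fun s hs => (hVx s hs).neg) (fun s hs x => ?_) (fun x => by linarith [(abs_le.1 (hVT x)).1])
      (fun ε hε => ?_) s hs x
    · linarith
    · rw [deriv.fun_neg, opA_neg]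
      linarith [(abs_le.1 (hsource s hs x)).1]
    · obtain ⟨R, hR⟩ := hlower ε hε
      exact ⟨R, fun s hs x hx => by linarith [hR s hs x hx]⟩
  refine ⟨hbound, ?_⟩
  obtain ⟨M, hM⟩ := isCompact_Icc.exists_bound_of_continuousOn (s := Set.Icc t T) hμc.continuousOn
  have hM0 : 0 ≤ M := (norm_nonneg _).trans (hM t ⟨le_rfl, htT.le⟩)
  have hTt : 0 < T - t := sub_pos.2 htT
  refine ⟨2 * cT + C₀ * (T - t) + M, by positivity, fun s hs x => ?_⟩
  have hzle : z s x ≤ (2 * cT + C₀ * (T - t) + M) * (1 + ‖x‖ ^ 2) := by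
    have h1 : μ s ≤ M := (le_abs_self _).trans (hM s hs)
    have h2 : C₀ * (T - s) ≤ C₀ * (T - t) := by gcongr; exact hs.1
    have h3 := mul_le_mul_of_nonneg_right h2 (sq_nonneg ‖x‖)
    have h4 := mul_nonneg hM0 (sq_nonneg ‖x‖)
    have h5 := mul_pos hC₀0 hTt
    rw [hz, hβ]
    linarith
  exact abs_le.2 ⟨by linarith [(hbound s hs x).1], (hbound s hs x).2.trans hzle⟩

end
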